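/- arXiv:2404.01971 — 2 statements merged into one kernel-verified Lean document; each statement's English description precedes it below -/
import Mathlib

section
/- Let ρ be the rank function of a matricube on the hypercuboid C(r), and let a ⊏ b be two distinct flats with ρ(b) ≥ ρ(a) + 2. Then there exists a flat c with a ⊏ c ⊏ b and ρ(c) = ρ(a) + 1. -/
namespace Matricube

variable {d : ℕ}

/-- Membership in the hypercuboid `C(r)` of width `r`. -/
def mem (r x : Fin d → ℕ) : Prop := ∀ i, x i ≤ r i

/-- The `i`-th standard unit vector `eᵢ`. -/
def e (d : ℕ) (i : Fin d) : Fin d → ℕ := fun j => if j = i then 1 else 0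

/-- The point `t · eᵢ` of the hypercuboid. -/
def unit (d : ℕ) (i : Fin d) (t : ℕ) : Fin d → ℕ := fun j => if j = i then t else 0

/-- Submodularity of a function on the hypercuboid `C(r)`. -/
def Submodular (r : Fin d → ℕ) (f : (Fin d → ℕ) → ℤ) : Prop :=
  ∀ x y : Fin d → ℕ, mem r x → mem r y → f (x ⊔ y) + f (x ⊓ y) ≤ f x + f y

/-- Axioms (R1)-(R2)-(R3) for the rank function of a matricube on `C(r)`. -/
def IsRankFunction (r : Fin d → ℕ) (ρ : (Fin d → ℕ) → ℤ) : Prop :=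
  (ρ 0 = 0 ∧ ∀ i : Fin d, ∀ t : ℕ, 1 ≤ t → t ≤ r i →
      ρ (unit d i t) - ρ (unit d i (t - 1)) ≤ 1) ∧
  (∀ x y : Fin d → ℕ, mem r x → mem r y → x ≤ y → ρ x ≤ ρ y) ∧
  Submodular r ρ

/-- Axiom (R1*): the matricube is simple. -/
def IsSimple (r : Fin d → ℕ) (ρ : (Fin d → ℕ) → ℤ) : Prop :=
  ∀ i : Fin d, 0 < r i ∧ ∀ t : ℕ, t ≤ r i → ρ (unit d i t) = (t : ℤ)

/-- A flat of the matricube given by the rank function `ρ` on `C(r)`. -/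
def IsFlat (r : Fin d → ℕ) (ρ : (Fin d → ℕ) → ℤ) (a : Fin d → ℕ) : Prop :=
  mem r a ∧ ∀ i : Fin d, mem r (a + e d i) → ρ (a + e d i) = ρ a + 1

/-- The set of flats of the matricube given by `ρ`. -/
def flats (r : Fin d → ℕ) (ρ : (Fin d → ℕ) → ℤ) : Set (Fin d → ℕ) :=
  {a | IsFlat r ρ a}

/-- `CoversIn S a b` : `b` covers `a` in the poset `S`. -/
def CoversIn (S : Set (Fin d → ℕ)) (a b : Fin d → ℕ) : Prop :=
  a ∈ S ∧ b ∈ S ∧ a < b ∧ ∀ z ∈ S, ¬(a < z ∧ z < b)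

/-- The rank function of the dual matricube. -/
def dualRank (r : Fin d → ℕ) (ρ : (Fin d → ℕ) → ℤ) : (Fin d → ℕ) → ℤ :=
  fun x => (∑ i, (x i : ℤ)) + ρ (r - x) - ρ r

/-- Join-closure of a set: joins of nonempty (finite) families of its elements. -/
def joinClosure (A : Set (Fin d → ℕ)) : Set (Fin d → ℕ) :=
  {x | ∃ S : Finset (Fin d → ℕ), S.Nonempty ∧ ↑S ⊆ A ∧ x = S.sup id}

/-- `a` is join-irreducible in `A` : `a` is not the join of any set of elements of `A \ {a}`. -/
def JoinIrredIn (A : Set (Fin d → ℕ)) (a : Fin d → ℕ) : Prop :=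
  ∀ S : Finset (Fin d → ℕ), S.Nonempty → ↑S ⊆ A \ {a} → S.sup id ≠ a

/-- The set of circuits of the matricube given by `ρ` on `C(r)`: the nonzero
join-irreducible elements of `CC = {r - a : a a flat of the dual matricube}`. -/
def circuits (r : Fin d → ℕ) (ρ : (Fin d → ℕ) → ℤ) : Set (Fin d → ℕ) :=
  {c | c ∈ (fun a => r - a) '' flats r (dualRank r ρ) ∧ c ≠ 0 ∧
    JoinIrredIn ((fun a => r - a) '' flats r (dualRank r ρ)) c}

/-- An independent of the matricube given by `ρ` on `C(r)`. -/
def IsIndep (r : Fin d → ℕ) (ρ : (Fin d → ℕ) → ℤ) (a : Fin d → ℕ) : Prop :=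
  mem r a ∧ ∀ i : Fin d, 1 ≤ a i → ρ (a - e d i) = ρ a - 1

/-- The set of independents of the matricube given by `ρ`. -/
def indeps (r : Fin d → ℕ) (ρ : (Fin d → ℕ) → ℤ) : Set (Fin d → ℕ) :=
  {a | IsIndep r ρ a}

/-- `b` is the removal of `i` in `a` (in `J`): `b ∈ J` differs from `a` only in the `i`-th
coordinate, `b i < a i`, and `b` has the largest `i`-th coordinate among such elements. -/
def IsRemovalAt (J : Set (Fin d → ℕ)) (a : Fin d → ℕ) (i : Fin d) (b : Fin d → ℕ) : Prop :=
  b ∈ J ∧ b i < a i ∧ (∀ j : Fin d, j ≠ i → b j = a j) ∧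
  ∀ c ∈ J, c i < a i → (∀ j : Fin d, j ≠ i → c j = a j) → c i ≤ b i

/-- `b` is a removal of `a` in `J`. -/
def IsRemoval (J : Set (Fin d → ℕ)) (a b : Fin d → ℕ) : Prop :=
  ∃ i : Fin d, IsRemovalAt J a i b

/-- Removals exist in `J`. -/
def RemovalsExist (J : Set (Fin d → ℕ)) : Prop :=
  ∀ a ∈ J, ∀ i : Fin d, 1 ≤ a i → ∃ b, IsRemovalAt J a i b

/-- `a` can be reduced to `0` by a sequence of `m` removals in `J`. -/
def ReducesTo (J : Set (Fin d → ℕ)) (a : Fin d → ℕ) (m : ℕ) : Prop :=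
  ∃ c : ℕ → (Fin d → ℕ), c 0 = a ∧ c m = 0 ∧ ∀ k, k < m → IsRemoval J (c k) (c (k + 1))

/-- `J` is orderable: removals exist and all sequences of removals reducing a given
element to `0` have the same length. -/
def Orderable (J : Set (Fin d → ℕ)) : Prop :=
  RemovalsExist J ∧
  ∀ a ∈ J, ∀ m₁ m₂ : ℕ, ReducesTo J a m₁ → ReducesTo J a m₂ → m₁ = m₂

/-- Axiom (I1) for independents. -/
def AxiomI1 (J : Set (Fin d → ℕ)) : Prop :=
  RemovalsExist J ∧
  ∀ p ∈ J, ∀ i j : Fin d, ∀ bi bj : Fin d → ℕ,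
    IsRemovalAt J p i bi → IsRemovalAt J p j bj →
    bi ⊓ bj ∈ J ∧
    {c ∈ J | bi ⊓ bj ≤ c ∧ c ≤ bi}.ncard = {c ∈ J | bi ⊓ bj ≤ c ∧ c ≤ bj}.ncard

/-- Axiom (I2) for independents, relative to a size function `sz`. -/
def AxiomI2 (J : Set (Fin d → ℕ)) (sz : (Fin d → ℕ) → ℕ) : Prop :=
  (∀ a ∈ J, ∀ b ∈ J, a < b → sz a < sz b) ∧
  ∀ a ∈ J, ∀ b ∈ J, sz a < sz b → 2 ≤ {k : Fin d | a k < b k}.ncard →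
    ∃ c ∈ J, c ≤ a ⊔ b ∧ sz a < sz c ∧ ∃ i : Fin d, a i < b i ∧ c i < b i

/-- `P` is a dot array on the hypercube `[r]^d`. -/
def IsDotArray (r : ℕ) (P : Set (Fin d → ℕ)) : Prop := ∀ x ∈ P, ∀ i, x i ≤ r

/-- `rank_j (P[a])`: the number of values `t` such that the upper principal subarray
`P[a]` contains a dot whose `j`-th coordinate equals `t`. -/
noncomputable def arrayRank (P : Set (Fin d → ℕ)) (a : Fin d → ℕ) (j : Fin d) : ℕ :=
  {t : ℕ | ∃ y ∈ P, a ≤ y ∧ y j = t}.ncard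

/-- `x` is a redundant position in the dot array `P`: `x` is the meet of at least two dotted
positions `≠ x`, each having at least one coordinate in common with `x`. -/
def Redundant (P : Set (Fin d → ℕ)) (x : Fin d → ℕ) : Prop :=
  ∃ S : Finset (Fin d → ℕ), 2 ≤ S.card ∧ ↑S ⊆ P \ {x} ∧
    (∀ y ∈ S, ∃ i, y i = x i) ∧ (∀ y ∈ S, x ≤ y) ∧ ∀ z : Fin d → ℕ, (∀ y ∈ S, z ≤ y) → z ≤ x

/-- A permutation array of width `r` and dimension `d`: a totally rankable dot array on
`[r]^d` of rank `r + 1` with no redundant dots. -/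
def IsPermutationArray (r : ℕ) (P : Set (Fin d → ℕ)) : Prop :=
  IsDotArray r P ∧
  (∀ a : Fin d → ℕ, (∀ i, a i ≤ r) → ∀ j j' : Fin d, arrayRank P a j = arrayRank P a j') ∧
  (∀ j : Fin d, arrayRank P 0 j = r + 1) ∧
  (∀ x ∈ P, ¬Redundant P x)

/-- An increasing path `c 0 = 0, …, c m = a` in `C(r)`, with step directions `ℓ`. -/
def IncPath (r : Fin d → ℕ) (c : ℕ → Fin d → ℕ) (ℓ : ℕ → Fin d) (m : ℕ)
    (a : Fin d → ℕ) : Prop :=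
  c 0 = 0 ∧ c m = a ∧ ∀ j, j < m → c (j + 1) = c j + e d (ℓ j) ∧ mem r (c (j + 1))

/-- Rank increments along a unit step are at most one. -/
theorem IsRankFunction.add_e_le {r : Fin d → ℕ} {ρ : (Fin d → ℕ) → ℤ}
    (h : IsRankFunction r ρ) {x : Fin d → ℕ} {i : Fin d} (hx : mem r (x + e d i)) :
    ρ (x + e d i) ≤ ρ x + 1 := by
  obtain ⟨⟨-, hunit⟩, -, hsub⟩ := h
  have hxi := hx i
  simp only [Pi.add_apply, e, if_true] at hxi
  have hmx : mem r x := fun j => (Nat.le_add_right _ _).trans (hx j)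
  have hmu : mem r (unit d i (x i + 1)) := by
    intro j
    by_cases hj : j = i
    · subst hj
      simpa [unit] using hxi
    · simp [unit, hj]
  have hs := hsub x (unit d i (x i + 1)) hmx hmu
  have hsup : x ⊔ unit d i (x i + 1) = x + e d i := by
    funext j
    by_cases hj : j = i
    · subst hj
      simp [unit, e]
    · simp [unit, e, hj]
  have hinf : x ⊓ unit d i (x i + 1) = unit d i (x i) := by
    funext j
    by_cases hj : j = i
    · subst hj
      simp [unit]
    · simp [unit, hj]
  have hu := hunit i (x i + 1) (by omega) hxi
  rw [hsup, hinf] at hs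
  rw [Nat.add_sub_cancel] at hu
  linarith

theorem add_e_le_of_lt {x b : Fin d → ℕ} {i : Fin d} (hxb : x ≤ b) (hi : x i < b i) :
    x + e d i ≤ b := by
  intro j
  by_cases hj : j = i
  · subst hj
    simpa [e] using hi
  · simpa [e, hj] using hxb j

/-- Below a flat `b`, a unit step in a direction where `x` agrees with `b` raises the rank. -/
theorem IsFlat.lt_add_e_of_le {r : Fin d → ℕ} {ρ : (Fin d → ℕ) → ℤ} {b : Fin d → ℕ}
    (hb : IsFlat r ρ b) (hρ : Submodular r ρ) {x : Fin d → ℕ} {i : Fin d} (hxb : x ≤ b)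
    (hi : x i = b i) (hx : mem r (x + e d i)) : ρ x + 1 ≤ ρ (x + e d i) := by
  have hs := hρ b (x + e d i) hb.1 hx
  have hsup : b ⊔ (x + e d i) = b + e d i := by
    funext j
    have := hxb j
    by_cases hj : j = i
    · subst hj
      simp [e, hi]
    · simpa [e, hj] using this
  have hinf : b ⊓ (x + e d i) = x := by
    funext j
    have := hxb j
    by_cases hj : j = i
    · subst hj
      simp [e, hi]
    · simpa [e, hj] using this
  have hbe : mem r (b + e d i) := by
    intro j
    rw [← hsup]
    exact max_le (hb.1 j) (hx j)
  have := hb.2 i hbe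
  rw [hsup, hinf] at hs
  linarith

/-- Between two comparable flats of rank difference at least two there is an
intermediate flat of rank one more than the smaller one. -/
theorem flat_grading (d : ℕ) (r : Fin d → ℕ) (ρ : (Fin d → ℕ) → ℤ)
    (h : IsRankFunction r ρ) (a b : Fin d → ℕ)
    (ha : IsFlat r ρ a) (hb : IsFlat r ρ b) (hab : a < b) (hrk : ρ a + 2 ≤ ρ b) :
    ∃ c : Fin d → ℕ, IsFlat r ρ c ∧ a < c ∧ c < b ∧ ρ c = ρ a + 1 := by
  obtain ⟨hle, i, hi⟩ := Pi.lt_def.1 hab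
  have hmem : ∀ x ≤ b, mem r x := fun x hx j => (hx j).trans (hb.1 j)
  have hai : a + e d i ≤ b := add_e_le_of_lt hle hi
  have hfin : {x | x ≤ b ∧ a + e d i ≤ x ∧ ρ x = ρ a + 1}.Finite :=
    (Set.finite_Iic b).subset fun x hx => hx.1
  obtain ⟨c, ⟨hcb, hac, hρc⟩, hmax⟩ :=
    hfin.exists_maximal ⟨a + e d i, hai, le_rfl, ha.2 i (hmem _ hai)⟩
  have hlt : a < a + e d i :=
    Pi.lt_def.2 ⟨fun j => Nat.le_add_right _ _, i, by simp [e]⟩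
  refine ⟨c, ⟨hmem c hcb, fun j hj => ?_⟩, hlt.trans_le hac, lt_of_le_of_ne hcb ?_, hρc⟩
  · refine le_antisymm (h.add_e_le hj) ?_
    rcases (hcb j).lt_or_eq with hcj | hcj
    · have hle' : c ≤ c + e d j := fun k => Nat.le_add_right _ _
      have hmono := h.2.1 c (c + e d j) (hmem c hcb) hj hle'
      by_contra hlt'
      have := hmax ⟨add_e_le_of_lt hcb hcj, hac.trans hle', by omega⟩ hle' j
      simp [e] at this
    · exact hb.lt_add_e_of_le h.2.2 hcb hcj hj
  · rintro rfl
    omega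

end Matricube
end

section
/- Let M be a simple matricube of rank r or r + 1 on the hypercube [r]^d with rank function ρ. Let P_M be the dot array on [r]^d with a dot at every flat a ≠ (r, …, r) of M, and, in addition, a dot at (r, …, r) in case the rank of M equals r. Then the dot array P = P_M ∖ R(P_M), obtained by removing from P_M all dots at redundant positions, is a permutation array of width r and dimension d. -/
namespace Matricube

variable {d : ℕ}

/-- The dot array `P_M` of a matricube of rank function `ρ` on `[r]^d`. -/
def flatDots (r : ℕ) (ρ : (Fin d → ℕ) → ℤ) : Set (Fin d → ℕ) :=
  {a | IsFlat (fun _ => r) ρ a ∧ a ≠ fun _ => r} ∪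
    {a | a = (fun _ => r : Fin d → ℕ) ∧ ρ (fun _ => r) = r}

lemma mem_sup_unit {r t : ℕ} {a : Fin d → ℕ} (ha : mem (fun _ => r) a) (j : Fin d)
    (ht : t ≤ r) : mem (fun _ => r) (a ⊔ unit d j t) := by
  intro i
  refine sup_le (ha i) ?_
  simp only [unit]
  split_ifs <;> omega

lemma rank_add_e_le {r : ℕ} {ρ : (Fin d → ℕ) → ℤ}
    (h : IsRankFunction (fun _ => r) ρ) (hs : IsSimple (fun _ => r) ρ)
    {x : Fin d → ℕ} (i : Fin d) (hx : mem (fun _ => r) x)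
    (hxi : mem (fun _ => r) (x + e d i)) : ρ (x + e d i) ≤ ρ x + 1 := by
  have hi : x i + 1 ≤ r := by simpa [e] using hxi i
  have hu : mem (fun _ => r) (unit d i (x i + 1)) := by
    intro k
    simp only [unit]
    split_ifs <;> omega
  have hsub := h.2.2 x (unit d i (x i + 1)) hx hu
  have hsup : x ⊔ unit d i (x i + 1) = x + e d i := by
    funext k
    by_cases hk : k = i
    · subst hk; simp [unit, e]
    · simp [unit, e, hk]
  have hinf : x ⊓ unit d i (x i + 1) = unit d i (x i) := by
    funext k
    by_cases hk : k = i
    · subst hk; simp [unit]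
    · simp [unit, hk]
  rw [hsup, hinf, (hs i).2 _ hi, (hs i).2 _ (hx i)] at hsub
  push_cast at hsub
  omega

lemma finite_mem (r : Fin d → ℕ) : {x : Fin d → ℕ | mem r x}.Finite :=
  (Set.finite_Iic r).subset fun _ hx => hx

/-- Every point lies below a flat of the same rank. -/
lemma exists_flat_ge {r : ℕ} {ρ : (Fin d → ℕ) → ℤ}
    (h : IsRankFunction (fun _ => r) ρ) (hs : IsSimple (fun _ => r) ρ)
    {x : Fin d → ℕ} (hx : mem (fun _ => r) x) :
    ∃ y, IsFlat (fun _ => r) ρ y ∧ x ≤ y ∧ ρ y = ρ x := by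
  have hfin : {y : Fin d → ℕ | mem (fun _ => r) y ∧ x ≤ y ∧ ρ y = ρ x}.Finite :=
    (finite_mem _).subset fun _ hy => hy.1
  obtain ⟨y, ⟨hy, hxy, hρ⟩, hmax⟩ := hfin.exists_maximal ⟨x, hx, le_rfl, rfl⟩
  refine ⟨y, ⟨hy, fun i hyi => ?_⟩, hxy, hρ⟩
  have hle : y ≤ y + e d i := fun k => Nat.le_add_right _ _
  have h1 := rank_add_e_le h hs i hy hyi
  have h2 := h.2.1 _ _ hy hyi hle
  have h3 : ρ (y + e d i) ≠ ρ y := fun heq => by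
    have := hmax ⟨hyi, hxy.trans hle, heq.trans hρ⟩ hle i
    simp [e] at this
  omega

/-- A flat above `a` with `j`-th coordinate `t < r` exists iff the rank jumps after
`a ⊔ t eⱼ` in direction `j`. -/
lemma exists_dot_iff_of_lt {r : ℕ} {ρ : (Fin d → ℕ) → ℤ}
    (h : IsRankFunction (fun _ => r) ρ) (hs : IsSimple (fun _ => r) ρ)
    {a : Fin d → ℕ} (ha : mem (fun _ => r) a) (j : Fin d) {t : ℕ} (ht : t < r) :
    (∃ y ∈ flatDots r ρ, a ≤ y ∧ y j = t) ↔
      ρ (a ⊔ unit d j (t + 1)) = ρ (a ⊔ unit d j t) + 1 := by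
  have hz := mem_sup_unit ha j ht.le
  have hw := mem_sup_unit ha j (show t + 1 ≤ r from ht)
  constructor
  · rintro ⟨y, (⟨hy, -⟩ | ⟨rfl, -⟩), hay, hyj⟩
    · have haj : a j ≤ t := hyj ▸ hay j
      have hwz : a ⊔ unit d j (t + 1) = a ⊔ unit d j t + e d j := by
        funext k
        by_cases hk : k = j
        · subst hk; simp [unit, e]; omega
        · simp [unit, e, hk]
      have hsup : y ⊔ (a ⊔ unit d j (t + 1)) = y + e d j := by
        funext k
        by_cases hk : k = j
        · subst hk; simp [unit, e]; omega
        · simpa [unit, e, hk] using hay k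
      have hinf : y ⊓ (a ⊔ unit d j (t + 1)) = a ⊔ unit d j t := by
        funext k
        by_cases hk : k = j
        · subst hk; simp [unit]; omega
        · simpa [unit, hk] using hay k
      have hye : mem (fun _ => r) (y + e d j) := by
        rw [← hsup]
        exact fun k => sup_le (hy.1 k) (hw k)
      have h1 := h.2.2 _ _ hy.1 hw
      rw [hsup, hinf, hy.2 j hye] at h1
      have h2 := rank_add_e_le h hs j hz (hwz ▸ hw)
      rw [← hwz] at h2
      omega
    · simp only at hyj
      omega
  · intro hjump
    obtain ⟨y, hy, hzy, hρ⟩ := exists_flat_ge h hs hz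
    have hay : a ≤ y := le_sup_left.trans hzy
    have h1 : t ≤ y j := by
      have := hzy j
      simp only [Pi.sup_apply, unit, if_true] at this
      exact le_sup_right.trans this
    have h2 : y j = t := by
      by_contra hne
      have hwy : a ⊔ unit d j (t + 1) ≤ y := by
        refine sup_le hay fun k => ?_
        by_cases hk : k = j
        · subst hk; simp [unit]; omega
        · simp [unit, hk]
      have := h.2.1 _ _ hw hy.1 hwy
      omega
    refine ⟨y, Or.inl ⟨hy, ?_⟩, hay, h2⟩
    rintro rfl
    simp only at h2
    omega

/-- A dot above `a` with `j`-th coordinate `r` exists iff `a ⊔ r eⱼ` has rank `r`. -/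
lemma exists_dot_iff_top {r : ℕ} {ρ : (Fin d → ℕ) → ℤ}
    (h : IsRankFunction (fun _ => r) ρ) (hs : IsSimple (fun _ => r) ρ)
    (hrank : ρ (fun _ => r) ≤ r + 1)
    {a : Fin d → ℕ} (ha : mem (fun _ => r) a) (j : Fin d) :
    (∃ y ∈ flatDots r ρ, a ≤ y ∧ y j = r) ↔ ρ (a ⊔ unit d j r) = r := by
  have hz := mem_sup_unit ha j le_rfl
  have htop : mem (fun _ => r) (fun _ : Fin d => r) := fun _ => le_rfl
  constructor
  · rintro ⟨y, hy, hay, hyj⟩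
    have hymem : mem (fun _ => r) y := by
      rcases hy with ⟨hy, -⟩ | ⟨rfl, -⟩
      exacts [hy.1, htop]
    have hzy : a ⊔ unit d j r ≤ y := by
      refine sup_le hay fun k => ?_
      by_cases hk : k = j
      · subst hk; simp [unit, hyj]
      · simp [unit, hk]
    have hu : mem (fun _ => r) (unit d j r) := by
      intro k
      simp only [unit]
      split_ifs <;> omega
    have h1 := h.2.1 _ _ hz hymem hzy
    have h2 := h.2.1 _ _ hu hz le_sup_right
    rw [(hs j).2 r le_rfl] at h2
    have h3 : ρ y ≤ r := by
      rcases hy with ⟨hy, hne⟩ | ⟨rfl, hρ⟩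
      · obtain ⟨i, hi⟩ := Function.ne_iff.1 hne
        have hlt : y i < r := lt_of_le_of_ne (hymem i) hi
        have hye : mem (fun _ => r) (y + e d i) := by
          intro k
          have := hymem k
          by_cases hk : k = i
          · subst hk; simp [e]; omega
          · simpa [e, hk] using this
        have h4 := hy.2 i hye
        have h5 := h.2.1 _ _ hye htop hye
        omega
      · exact hρ.le
    omega
  · intro hρz
    obtain ⟨y, hy, hzy, hρ⟩ := exists_flat_ge h hs hz
    have hyj : y j = r := by
      refine le_antisymm (hy.1 j) ?_
      have := hzy j
      simp only [Pi.sup_apply, unit, if_true] at this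
      exact le_sup_right.trans this
    refine ⟨y, ?_, le_sup_left.trans hzy, hyj⟩
    by_cases hne : y = fun _ => r
    · subst hne
      exact Or.inr ⟨rfl, hρ.trans hρz⟩
    · exact Or.inl ⟨hy, hne⟩

/-- The number of jumps of a sequence with increments in `{0, 1}`. -/
lemma card_jumps (g : ℕ → ℤ) (n : ℕ) (hg : ∀ t < n, g (t + 1) = g t ∨ g (t + 1) = g t + 1) :
    (((Finset.range n).filter fun t => g (t + 1) = g t + 1).card : ℤ) = g n - g 0 := by
  rw [← Finset.sum_range_sub, Finset.card_filter]
  push_cast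
  refine Finset.sum_congr rfl fun t ht => ?_
  rcases hg t (Finset.mem_range.1 ht) with h | h <;> simp [h]

lemma arrayRank_flatDots {r : ℕ} {ρ : (Fin d → ℕ) → ℤ}
    (h : IsRankFunction (fun _ => r) ρ) (hs : IsSimple (fun _ => r) ρ)
    (hrank : ρ (fun _ => r) ≤ r + 1)
    {a : Fin d → ℕ} (ha : mem (fun _ => r) a) (j : Fin d) :
    (arrayRank (flatDots r ρ) a j : ℤ) = r + 1 - ρ a := by
  set g : ℕ → ℤ := fun t => if t ≤ r then ρ (a ⊔ unit d j t) else r + 1 with hgdef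
  have hlow : ∀ t ≤ r, g t = ρ (a ⊔ unit d j t) := fun t ht => if_pos ht
  have htop : g (r + 1) = r + 1 := if_neg (by omega)
  have hset : {t : ℕ | ∃ y ∈ flatDots r ρ, a ≤ y ∧ y j = t} =
      ((Finset.range (r + 1)).filter fun t => g (t + 1) = g t + 1 : Finset ℕ) := by
    ext t
    simp only [Set.mem_ofPred_eq, Finset.coe_filter, Finset.mem_range]
    rcases lt_trichotomy t r with ht | rfl | ht
    · rw [exists_dot_iff_of_lt h hs ha j ht, hlow _ ht.le, hlow _ ht]
      simp only [iff_and_self]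
      omega
    · rw [exists_dot_iff_top h hs hrank ha j, hlow _ le_rfl, htop]
      constructor
      · intro h'; constructor <;> omega
      · omega
    · constructor
      · rintro ⟨y, (⟨hy, -⟩ | ⟨rfl, -⟩), -, hyj⟩
        · have := hy.1 j
          simp only at this
          omega
        · simp only at hyj
          omega
      · omega
  have hstep : ∀ t < r + 1, g (t + 1) = g t ∨ g (t + 1) = g t + 1 := by
    intro t ht
    rcases (Nat.lt_succ_iff.1 ht).lt_or_eq with ht | rfl
    · rw [hlow t ht.le, hlow (t + 1) ht]
      have hz := mem_sup_unit ha j ht.le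
      have hw := mem_sup_unit ha j (show t + 1 ≤ r from ht)
      by_cases haj : a j ≤ t
      · have hwz : a ⊔ unit d j (t + 1) = a ⊔ unit d j t + e d j := by
          funext k
          by_cases hk : k = j
          · subst hk; simp [unit, e]; omega
          · simp [unit, e, hk]
        have hle : a ⊔ unit d j t ≤ a ⊔ unit d j (t + 1) := by
          rw [hwz]
          exact fun k => Nat.le_add_right _ _
        have h1 := h.2.1 _ _ hz hw hle
        have h2 := rank_add_e_le h hs j hz (hwz ▸ hw)
        rw [← hwz] at h2
        omega
      · left
        congr 1
        funext k
        by_cases hk : k = j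
        · subst hk; simp [unit]; omega
        · simp [unit, hk]
    · rw [htop, hlow _ le_rfl]
      have hz := mem_sup_unit ha j (le_refl t)
      have hu : mem (fun _ => t) (unit d j t) := by
        intro k
        simp only [unit]
        split_ifs <;> omega
      have h1 := h.2.1 _ _ hu hz le_sup_right
      have h2 := h.2.1 _ _ hz (fun _ => le_rfl) hz
      rw [(hs j).2 t le_rfl] at h1
      omega
  have hzero : g 0 = ρ a := by
    rw [hlow 0 (Nat.zero_le _)]
    congr 1
    funext k
    simp [unit]
  rw [arrayRank, hset, Set.ncard_coe_finset, card_jumps g _ hstep, htop, hzero]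

/-- Removing the redundant dots of a dot array does not change the ranks of its upper
principal subarrays. -/
lemma arrayRank_sep_not_redundant {r : ℕ} {P : Set (Fin d → ℕ)} (hP : IsDotArray r P)
    (a : Fin d → ℕ) (j : Fin d) :
    arrayRank {x ∈ P | ¬Redundant P x} a j = arrayRank P a j := by
  unfold arrayRank
  congr 1
  ext t
  constructor
  · rintro ⟨y, hy, hay, hyj⟩
    exact ⟨y, hy.1, hay, hyj⟩
  · rintro ⟨x, hx, hax, hxj⟩
    have hfin : {y | y ∈ P ∧ a ≤ y ∧ y j = t}.Finite :=
      (finite_mem fun _ => r).subset fun y hy => hP y hy.1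
    obtain ⟨y, ⟨hy, hay, hyj⟩, hmax⟩ := hfin.exists_maximal ⟨x, hx, hax, hxj⟩
    refine ⟨y, ⟨hy, ?_⟩, hay, hyj⟩
    rintro ⟨S, -, hSP, -, hle, hglb⟩
    have hlt : ∀ s ∈ S, y j < s j := by
      intro s hs
      refine lt_of_le_of_ne (hle s hs j) fun heq => ?_
      have hsy := hmax ⟨(hSP hs).1, hay.trans (hle s hs), heq ▸ hyj⟩ (hle s hs)
      exact (hSP hs).2 (le_antisymm hsy (hle s hs))
    have := hglb (y + e d j) (fun s hs k => by
      by_cases hk : k = j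
      · subst hk; simpa [e] using hlt s hs
      · simpa [e, hk] using hle s hs k) j
    simp [e] at this

lemma Redundant.mono {P Q : Set (Fin d → ℕ)} (hPQ : P ⊆ Q) {x : Fin d → ℕ}
    (hx : Redundant P x) : Redundant Q x := by
  obtain ⟨S, hcard, hSP, hrest⟩ := hx
  exact ⟨S, hcard, hSP.trans (Set.sdiff_subset_sdiff_left hPQ), hrest⟩

/-- From a simple matricube of rank `r` or `r + 1` on `[r]^d`, dotting the flats
`≠ (r, …, r)` (and also `(r, …, r)` if the rank is `r`) and removing the dots at redundant
positions yields a permutation array of width `r` and dimension `d`. -/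
theorem matricube_to_permutation_array (d r : ℕ) (hd : 0 < d) (hr : 0 < r)
    (ρ : (Fin d → ℕ) → ℤ)
    (h : IsRankFunction (fun _ => r) ρ) (hs : IsSimple (fun _ => r) ρ)
    (hrank : ρ (fun _ => r) = r ∨ ρ (fun _ => r) = r + 1) :
    IsPermutationArray r
      {x ∈ ({a | IsFlat (fun _ => r) ρ a ∧ a ≠ fun _ => r} ∪
          {a | a = (fun _ => r : Fin d → ℕ) ∧ ρ (fun _ => r) = r}) |
        ¬Redundant ({a | IsFlat (fun _ => r) ρ a ∧ a ≠ fun _ => r} ∪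
          {a | a = (fun _ => r : Fin d → ℕ) ∧ ρ (fun _ => r) = r}) x} := by
  have hrank' : ρ (fun _ => r) ≤ r + 1 := by omega
  have hP : IsDotArray r (flatDots r ρ) := by
    rintro x (⟨hx, -⟩ | ⟨rfl, -⟩) i
    exacts [hx.1 i, le_rfl]
  change IsPermutationArray r {x ∈ flatDots r ρ | ¬Redundant (flatDots r ρ) x}
  refine ⟨fun x hx => hP x hx.1, fun a ha j j' => ?_, fun j => ?_,
    fun x hx hred => hx.2 (hred.mono fun _ hy => hy.1)⟩
  · rw [arrayRank_sep_not_redundant hP, arrayRank_sep_not_redundant hP]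
    have h1 := arrayRank_flatDots h hs hrank' ha j
    have h2 := arrayRank_flatDots h hs hrank' ha j'
    omega
  · rw [arrayRank_sep_not_redundant hP]
    have h1 := arrayRank_flatDots h hs hrank' (a := 0) (fun _ => Nat.zero_le _) j
    rw [h.1.1] at h1
    omega

end Matricube
end
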